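/- arXiv:2111.02969 — 2 statements merged into one kernel-verified Lean document; each statement's English description precedes it below -/
import Mathlib

section
/- Let U be an open subset of Fin s → ℂ on which the coordinates are pairwise distinct. Let A : U → M_n(ℂ) and 𝒟_j : U → M_n(ℂ) (j : Fin s) be holomorphic, with each 𝒟_j(λ) block-diagonal, let ω_j(λ) be defined from A(λ) and λ by the standard off-block formula, and set ω̃_j = ω_j + 𝒟_j. Assume the deformation equations ∂_k A = [ω̃_k, A] hold on U for every k : Fin s. Then for all i, j : Fin s, the identity ∂_i ω̃_j − ∂_j ω̃_i − [ω̃_i, ω̃_j] = ∂_i 𝒟_j − ∂_j 𝒟_i − [𝒟_i, 𝒟_j] holds on U; equivalently, the block-off-diagonal part of the curvature vanishes identically: ∂_i ω_j − ∂_j ω_i = [ω_i, ω_j] + [ω_i, 𝒟_j] + [𝒟_i, ω_j]. -/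
open Matrix

/-- The matrix `ω j` defined from `A` and `λ` by the standard off-block formula. -/
noncomputable def omM {n s : ℕ} (bk : Fin n → Fin s) (lam : Fin s → ℂ)
    (A : Matrix (Fin n) (Fin n) ℂ) (j : Fin s) : Matrix (Fin n) (Fin n) ℂ :=
  Matrix.of fun i k =>
    if bk i = bk k then 0
    else ((if bk i = j then (1 : ℂ) else 0) - (if bk k = j then (1 : ℂ) else 0)) * A i k
        / (lam (bk i) - lam (bk k))

/-- `ω_j` as a matrix-valued function of the deformation parameter `λ`. -/
noncomputable def omF {n s : ℕ} (bk : Fin n → Fin s)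
    (A : (Fin s → ℂ) → Matrix (Fin n) (Fin n) ℂ) (j : Fin s)
    (x : Fin s → ℂ) : Matrix (Fin n) (Fin n) ℂ :=
  omM bk x (A x) j

/-- `ω̃_j = ω_j + 𝒟_j` as a matrix-valued function of `λ`. -/
noncomputable def tomF {n s : ℕ} (bk : Fin n → Fin s)
    (A : (Fin s → ℂ) → Matrix (Fin n) (Fin n) ℂ)
    (DD : Fin s → (Fin s → ℂ) → Matrix (Fin n) (Fin n) ℂ) (j : Fin s)
    (x : Fin s → ℂ) : Matrix (Fin n) (Fin n) ℂ :=
  omF bk A j x + DD j x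

/-- Entrywise partial derivative `∂_j F` of a matrix-valued function on `ℂ^s`. -/
noncomputable def pd {n s : ℕ} (F : (Fin s → ℂ) → Matrix (Fin n) (Fin n) ℂ)
    (j : Fin s) (x : Fin s → ℂ) : Matrix (Fin n) (Fin n) ℂ :=
  Matrix.of fun p q => fderiv ℂ (fun y => F y p q) x (Pi.single j 1)

theorem commutator_commutator_eq_of_commutators {R : Type*} [Ring R] {L E F A S T : R}
    (hS : L * S - S * L = E * A - A * E) (hT : L * T - T * L = F * A - A * F)
    (hST : F * S - S * F = E * T - T * E) :
    L * (S * T - T * S) - (S * T - T * S) * L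
      = (F * (S * A - A * S) - (S * A - A * S) * F)
        - (E * (T * A - A * T) - (T * A - A * T) * E) := by
  linear_combination (norm := noncomm_ring)
    (hS * T - T * hS) + (S * hT - hT * S) - (hST * A - A * hST)

theorem diagonal_commutator_apply {m R : Type*} [Fintype m] [DecidableEq m] [CommRing R]
    (v : m → R) (X : Matrix m m R) (p q : m) :
    (diagonal v * X - X * diagonal v) p q = (v p - v q) * X p q := by
  rw [Matrix.sub_apply, diagonal_mul, mul_diagonal]
  ring

theorem mul_apply_eq_zero_of_blockDiagonal {m o R : Type*} [Fintype m] [Semiring R]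
    {bk : m → o} {X Y : Matrix m m R}
    (hX : ∀ p q, bk p ≠ bk q → X p q = 0) (hY : ∀ p q, bk p ≠ bk q → Y p q = 0)
    {p q : m} (h : bk p ≠ bk q) : (X * Y) p q = 0 := by
  rw [mul_apply]
  refine Finset.sum_eq_zero fun r _ => ?_
  by_cases hr : bk p = bk r
  · rw [hY r q (hr ▸ h), mul_zero]
  · rw [hX p r hr, zero_mul]

theorem mul_apply_eq_zero_of_offDiagonal_of_blockDiagonal {m o R : Type*} [Fintype m]
    [Semiring R] {bk : m → o} {X Y : Matrix m m R}
    (hX : ∀ p q, bk p = bk q → X p q = 0) (hY : ∀ p q, bk p ≠ bk q → Y p q = 0)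
    {p q : m} (h : bk p = bk q) : (X * Y) p q = 0 := by
  rw [mul_apply]
  refine Finset.sum_eq_zero fun r _ => ?_
  by_cases hr : bk p = bk r
  · rw [hX p r hr, zero_mul]
  · rw [hY r q (fun h' => hr (h.trans h'.symm)), mul_zero]

theorem mul_apply_eq_zero_of_blockDiagonal_of_offDiagonal {m o R : Type*} [Fintype m]
    [Semiring R] {bk : m → o} {X Y : Matrix m m R}
    (hX : ∀ p q, bk p ≠ bk q → X p q = 0) (hY : ∀ p q, bk p = bk q → Y p q = 0)
    {p q : m} (h : bk p = bk q) : (X * Y) p q = 0 := by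
  rw [mul_apply]
  refine Finset.sum_eq_zero fun r _ => ?_
  by_cases hr : bk p = bk r
  · rw [hY r q (hr.symm.trans h), mul_zero]
  · rw [hX p r hr, zero_mul]

section Om

variable {n s : ℕ} (bk : Fin n → Fin s)

theorem omM_apply_of_eq (lam : Fin s → ℂ) (A : Matrix (Fin n) (Fin n) ℂ) (j : Fin s)
    {p q : Fin n} (h : bk p = bk q) : omM bk lam A j p q = 0 := by
  simp [omM, h]

theorem omM_apply_of_ne (lam : Fin s → ℂ) (A : Matrix (Fin n) (Fin n) ℂ) (j : Fin s)
    {p q : Fin n} (h : bk p ≠ bk q) :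
    omM bk lam A j p q
      = ((if bk p = j then (1 : ℂ) else 0) - (if bk q = j then (1 : ℂ) else 0)) * A p q
        / (lam (bk p) - lam (bk q)) := by
  simp [omM, h]

/-- `ω_j` solves `[Λ, ω_j] = [E_j, A]`. -/
theorem sub_mul_omM_apply {lam : Fin s → ℂ} (hlam : ∀ a b, a ≠ b → lam a ≠ lam b)
    (A : Matrix (Fin n) (Fin n) ℂ) (j : Fin s) (p q : Fin n) :
    (lam (bk p) - lam (bk q)) * omM bk lam A j p q
      = ((if bk p = j then (1 : ℂ) else 0) - (if bk q = j then (1 : ℂ) else 0)) * A p q := by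
  by_cases h : bk p = bk q
  · simp [h]
  · rw [omM_apply_of_ne bk lam A j h, mul_div_cancel₀ _ (sub_ne_zero.2 (hlam _ _ h))]

theorem indicator_sub_mul_omM_comm (lam : Fin s → ℂ) (A : Matrix (Fin n) (Fin n) ℂ)
    (i j : Fin s) (p q : Fin n) :
    ((if bk p = j then (1 : ℂ) else 0) - (if bk q = j then (1 : ℂ) else 0)) * omM bk lam A i p q
      = ((if bk p = i then (1 : ℂ) else 0) - (if bk q = i then (1 : ℂ) else 0))
        * omM bk lam A j p q := by
  by_cases h : bk p = bk q
  · simp [h]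
  · rw [omM_apply_of_ne bk lam A i h, omM_apply_of_ne bk lam A j h]
    ring

theorem omM_mul_omM_apply_comm (lam : Fin s → ℂ) (A : Matrix (Fin n) (Fin n) ℂ)
    (i j : Fin s) {p q : Fin n} (h : bk p = bk q) :
    (omM bk lam A i * omM bk lam A j) p q = (omM bk lam A j * omM bk lam A i) p q := by
  rw [mul_apply, mul_apply]
  refine Finset.sum_congr rfl fun r _ => ?_
  by_cases hr : bk p = bk r
  · simp [omM_apply_of_eq bk lam A _ hr]
  · have hr' : bk r ≠ bk q := fun h' => hr (h.trans h'.symm)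
    rw [omM_apply_of_ne bk lam A i hr, omM_apply_of_ne bk lam A j hr,
      omM_apply_of_ne bk lam A i hr', omM_apply_of_ne bk lam A j hr', h]
    ring

theorem pd_omF_apply_of_eq (A : (Fin s → ℂ) → Matrix (Fin n) (Fin n) ℂ) (i j : Fin s)
    (x : Fin s → ℂ) {p q : Fin n} (h : bk p = bk q) : pd (omF bk A j) i x p q = 0 := by
  simp [pd, omF, omM_apply_of_eq bk _ _ j h]

variable {bk} {A : (Fin s → ℂ) → Matrix (Fin n) (Fin n) ℂ} {x : Fin s → ℂ}

theorem hasFDerivAt_omF_apply (hlam : ∀ a b, a ≠ b → x a ≠ x b) (j : Fin s)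
    {p q : Fin n} (hA : DifferentiableAt ℂ (fun y => A y p q) x) (h : bk p ≠ bk q) :
    HasFDerivAt (fun y => omF bk A j y p q)
      ((((if bk p = j then (1 : ℂ) else 0) - (if bk q = j then (1 : ℂ) else 0))
          / (x (bk p) - x (bk q))) • fderiv ℂ (fun y => A y p q) x
        - (((if bk p = j then (1 : ℂ) else 0) - (if bk q = j then (1 : ℂ) else 0)) * A x p q
          / (x (bk p) - x (bk q)) ^ 2) •
          (ContinuousLinearMap.proj (R := ℂ) (φ := fun _ : Fin s => ℂ) (bk p)
            - ContinuousLinearMap.proj (R := ℂ) (φ := fun _ : Fin s => ℂ) (bk q))) x := by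
  have hd : x (bk p) - x (bk q) ≠ 0 := sub_ne_zero.2 (hlam _ _ h)
  have hden : HasFDerivAt (fun y : Fin s → ℂ => y (bk p) - y (bk q))
      (ContinuousLinearMap.proj (R := ℂ) (φ := fun _ : Fin s => ℂ) (bk p)
        - ContinuousLinearMap.proj (R := ℂ) (φ := fun _ : Fin s => ℂ) (bk q)) x :=
    (hasFDerivAt_apply (bk p) x).sub (hasFDerivAt_apply (bk q) x)
  have hnum := hA.hasFDerivAt.const_mul
    ((if bk p = j then (1 : ℂ) else 0) - (if bk q = j then (1 : ℂ) else 0))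
  have hinv := (hasDerivAt_inv hd).comp_hasFDerivAt x hden
  simp only [omF, omM_apply_of_ne bk _ _ j h, div_eq_mul_inv]
  refine (hnum.mul hinv).congr_fderiv ?_
  ext v
  simp
  field_simp
  ring

theorem differentiableAt_omF_apply (hlam : ∀ a b, a ≠ b → x a ≠ x b) (j : Fin s)
    {p q : Fin n} (hA : DifferentiableAt ℂ (fun y => A y p q) x) :
    DifferentiableAt ℂ (fun y => omF bk A j y p q) x := by
  by_cases h : bk p = bk q
  · simp [omF, omM_apply_of_eq bk _ _ j h]
  · exact (hasFDerivAt_omF_apply hlam j hA h).differentiableAt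

/-- The terms coming from the denominators cancel in `∂_i ω_j − ∂_j ω_i`. -/
theorem sub_mul_pd_omF_sub_pd_omF_apply (hlam : ∀ a b, a ≠ b → x a ≠ x b) (i j : Fin s)
    {p q : Fin n} (hA : DifferentiableAt ℂ (fun y => A y p q) x) (h : bk p ≠ bk q) :
    (x (bk p) - x (bk q)) * (pd (omF bk A j) i x - pd (omF bk A i) j x) p q
      = ((if bk p = j then (1 : ℂ) else 0) - (if bk q = j then (1 : ℂ) else 0)) * pd A i x p q
        - ((if bk p = i then (1 : ℂ) else 0) - (if bk q = i then (1 : ℂ) else 0))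
          * pd A j x p q := by
  have hd : x (bk p) - x (bk q) ≠ 0 := sub_ne_zero.2 (hlam _ _ h)
  simp only [pd, Matrix.sub_apply, of_apply, (hasFDerivAt_omF_apply hlam _ hA h).fderiv,
    _root_.sub_apply, _root_.smul_apply,
    ContinuousLinearMap.proj_apply, Pi.single_apply, smul_eq_mul]
  field_simp
  ring

theorem pd_add {F G : (Fin s → ℂ) → Matrix (Fin n) (Fin n) ℂ}
    (hF : ∀ p q, DifferentiableAt ℂ (fun y => F y p q) x)
    (hG : ∀ p q, DifferentiableAt ℂ (fun y => G y p q) x) (i : Fin s) :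
    pd (fun y => F y + G y) i x = pd F i x + pd G i x := by
  ext p q
  simp only [pd, Matrix.add_apply, of_apply, fderiv_fun_add (hF p q) (hG p q),
    _root_.add_apply]

end Om

theorem statement5 {n s : ℕ} (hn : 0 < n) (hs : 0 < s) (bk : Fin n → Fin s)
    (U : Set (Fin s → ℂ)) (hU : IsOpen U)
    (hdist : ∀ x ∈ U, ∀ a b : Fin s, a ≠ b → x a ≠ x b)
    (A : (Fin s → ℂ) → Matrix (Fin n) (Fin n) ℂ)
    (hA : ∀ p q : Fin n, DifferentiableOn ℂ (fun y => A y p q) U)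
    (DD : Fin s → (Fin s → ℂ) → Matrix (Fin n) (Fin n) ℂ)
    (hDdiff : ∀ (j : Fin s) (p q : Fin n), DifferentiableOn ℂ (fun y => DD j y p q) U)
    (hDbd : ∀ j : Fin s, ∀ x ∈ U, ∀ p q : Fin n, bk p ≠ bk q → DD j x p q = 0)
    -- the deformation equations ∂_k A = [ω̃_k, A] on U
    (hdef : ∀ k : Fin s, ∀ x ∈ U,
      pd A k x = tomF bk A DD k x * A x - A x * tomF bk A DD k x) :
    ∀ i j : Fin s, ∀ x ∈ U,
      -- ∂_i ω̃_j − ∂_j ω̃_i − [ω̃_i, ω̃_j] = ∂_i 𝒟_j − ∂_j 𝒟_i − [𝒟_i, 𝒟_j]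
      (pd (tomF bk A DD j) i x - pd (tomF bk A DD i) j x
          - (tomF bk A DD i x * tomF bk A DD j x - tomF bk A DD j x * tomF bk A DD i x)
        = pd (DD j) i x - pd (DD i) j x - (DD i x * DD j x - DD j x * DD i x))
      ∧
      -- equivalently, the block-off-diagonal part of the curvature vanishes:
      -- ∂_i ω_j − ∂_j ω_i = [ω_i, ω_j] + [ω_i, 𝒟_j] + [𝒟_i, ω_j]
      (pd (omF bk A j) i x - pd (omF bk A i) j x
        = (omF bk A i x * omF bk A j x - omF bk A j x * omF bk A i x)
          + (omF bk A i x * DD j x - DD j x * omF bk A i x)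
          + (DD i x * omF bk A j x - omF bk A j x * DD i x)) := by
  intro i j x hx
  have hlam := hdist x hx
  have hAx : ∀ p q, DifferentiableAt ℂ (fun y => A y p q) x := fun p q =>
    (hA p q).differentiableAt (hU.mem_nhds hx)
  have hDx : ∀ k p q, DifferentiableAt ℂ (fun y => DD k y p q) x := fun k p q =>
    (hDdiff k p q).differentiableAt (hU.mem_nhds hx)
  have hD : ∀ k p q, bk p ≠ bk q → DD k x p q = 0 := fun k => hDbd k x hx
  have hom : ∀ k p q, bk p = bk q → omF bk A k x p q = 0 := fun k _ _ =>
    omM_apply_of_eq bk x (A x) k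
  have hcurv : pd (omF bk A j) i x - pd (omF bk A i) j x
        = (omF bk A i x * omF bk A j x - omF bk A j x * omF bk A i x)
          + (omF bk A i x * DD j x - DD j x * omF bk A i x)
          + (DD i x * omF bk A j x - omF bk A j x * DD i x) := by
    ext p q
    by_cases h : bk p = bk q
    · have hcomm : (omF bk A i x * omF bk A j x) p q = (omF bk A j x * omF bk A i x) p q :=
        omM_mul_omM_apply_comm bk x (A x) i j h
      simp only [Matrix.sub_apply, Matrix.add_apply, pd_omF_apply_of_eq bk A _ _ x h, hcomm,
        mul_apply_eq_zero_of_offDiagonal_of_blockDiagonal (hom _) (hD _) h,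
        mul_apply_eq_zero_of_blockDiagonal_of_offDiagonal (hD _) (hom _) h, sub_self, add_zero]
    · let L : Matrix (Fin n) (Fin n) ℂ := diagonal fun p => x (bk p)
      let E : Fin s → Matrix (Fin n) (Fin n) ℂ := fun k =>
        diagonal fun p => if bk p = k then (1 : ℂ) else 0
      have hL : ∀ k, L * tomF bk A DD k x - tomF bk A DD k x * L = E k * A x - A x * E k := by
        intro k
        ext a b
        rw [diagonal_commutator_apply, diagonal_commutator_apply,
          ← sub_mul_omM_apply bk hlam]
        by_cases hab : bk a = bk b
        · simp [hab]
        · simp [tomF, omF, hD k a b hab]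
      have hE : E j * tomF bk A DD i x - tomF bk A DD i x * E j
          = E i * tomF bk A DD j x - tomF bk A DD j x * E i := by
        ext a b
        rw [diagonal_commutator_apply, diagonal_commutator_apply]
        by_cases hab : bk a = bk b
        · simp [hab]
        · simpa [tomF, omF, hD _ a b hab] using indicator_sub_mul_omM_comm bk x (A x) i j a b
      have hmat := commutator_commutator_eq_of_commutators (hL i) (hL j) hE
      have hcc := congrFun₂ hmat p q
      rw [diagonal_commutator_apply, Matrix.sub_apply (_ - _), diagonal_commutator_apply,
        diagonal_commutator_apply, ← hdef i x hx, ← hdef j x hx,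
        ← sub_mul_pd_omF_sub_pd_omF_apply hlam i j (hAx p q) h] at hcc
      rw [← mul_left_cancel₀ (sub_ne_zero.2 (hlam _ _ h)) hcc]
      have hij := mul_apply_eq_zero_of_blockDiagonal (hD i) (hD j) h
      have hji := mul_apply_eq_zero_of_blockDiagonal (hD j) (hD i) h
      simp only [tomF, add_mul, mul_add, Matrix.sub_apply, Matrix.add_apply, hij, hji]
      ring
  refine ⟨?_, hcurv⟩
  have hpd : ∀ k l, pd (tomF bk A DD k) l x = pd (omF bk A k) l x + pd (DD k) l x := fun k l =>
    pd_add (fun p q => differentiableAt_omF_apply hlam k (hAx p q)) (hDx k) l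
  rw [hpd, hpd, tomF, tomF]
  linear_combination (norm := noncomm_ring) hcurv
end

section
/- Let U ⊆ ℂ^s be open and connected. Let 𝒟_j : U → M_n(ℂ) (j = 1,…,s) be continuous, let T : U → M_n(ℂ) be differentiable with T(λ) invertible for every λ ∈ U and ∂_j T = 𝒟_j · T on U for all j, and let B : U → M_n(ℂ) be differentiable with ∂_j B = [𝒟_j, B] on U for all j. Then the map λ ↦ T(λ)⁻¹ · B(λ) · T(λ) is constant on U. In particular, if B(λ₀) is similar to a Jordan matrix J via T(λ₀), then B(λ) = T(λ) J T(λ)⁻¹ for all λ ∈ U, so B(λ) has the constant Jordan form J. -/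
open Matrix

section EntrywiseCalculus

variable {n s : ℕ}

theorem differentiableAt_mul_entry {F G : (Fin s → ℂ) → Matrix (Fin n) (Fin n) ℂ}
    {x : Fin s → ℂ}
    (hF : ∀ p q, DifferentiableAt ℂ (fun y => F y p q) x)
    (hG : ∀ p q, DifferentiableAt ℂ (fun y => G y p q) x) (p q : Fin n) :
    DifferentiableAt ℂ (fun y => (F y * G y) p q) x := by
  simp only [Matrix.mul_apply]
  exact DifferentiableAt.fun_sum fun k _ => (hF p k).mul (hG k q)

theorem differentiableAt_det {F : (Fin s → ℂ) → Matrix (Fin n) (Fin n) ℂ} {x : Fin s → ℂ}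
    (hF : ∀ p q, DifferentiableAt ℂ (fun y => F y p q) x) :
    DifferentiableAt ℂ (fun y => (F y).det) x := by
  simp only [Matrix.det_apply']
  exact DifferentiableAt.fun_sum fun σ _ =>
    (differentiableAt_const _).mul
      (HasFDerivAt.finsetProd fun i _ => (hF (σ i) i).hasFDerivAt).differentiableAt

theorem differentiableAt_inv_entry {F : (Fin s → ℂ) → Matrix (Fin n) (Fin n) ℂ}
    {x : Fin s → ℂ} (hF : ∀ p q, DifferentiableAt ℂ (fun y => F y p q) x)
    (hx : IsUnit (F x).det) (p q : Fin n) :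
    DifferentiableAt ℂ (fun y => (F y)⁻¹ p q) x := by
  simp only [Matrix.inv_def, Ring.inverse_eq_inv', Matrix.smul_apply, smul_eq_mul,
    Matrix.adjugate_apply]
  refine ((differentiableAt_det hF).inv hx.ne_zero).mul (differentiableAt_det fun i j => ?_)
  simp only [Matrix.updateRow_apply]
  split_ifs
  · exact differentiableAt_const _
  · exact hF i j

theorem pd_mul {F G : (Fin s → ℂ) → Matrix (Fin n) (Fin n) ℂ} {x : Fin s → ℂ}
    (hF : ∀ p q, DifferentiableAt ℂ (fun y => F y p q) x)
    (hG : ∀ p q, DifferentiableAt ℂ (fun y => G y p q) x) (j : Fin s) :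
    pd (fun y => F y * G y) j x = pd F j x * G x + F x * pd G j x := by
  ext p q
  simp only [pd, Matrix.of_apply, Matrix.add_apply, Matrix.mul_apply]
  rw [fderiv_fun_sum fun k _ => (hF p k).fun_mul (hG k q), _root_.sum_apply,
    ← Finset.sum_add_distrib]
  refine Finset.sum_congr rfl fun k _ => ?_
  rw [fderiv_fun_mul (hF p k) (hG k q)]
  simp only [_root_.add_apply, _root_.smul_apply, smul_eq_mul]
  ring

theorem pd_congr_of_eventuallyEq {F G : (Fin s → ℂ) → Matrix (Fin n) (Fin n) ℂ}
    {x : Fin s → ℂ} (h : F =ᶠ[nhds x] G) (j : Fin s) : pd F j x = pd G j x := by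
  ext p q
  have hpq : (fun y => F y p q) =ᶠ[nhds x] fun y => G y p q :=
    h.mono fun y hy => congrFun (congrFun hy p) q
  simp only [pd, Matrix.of_apply, hpq.fderiv_eq]

theorem eq_of_pd_eq_zero {F : (Fin s → ℂ) → Matrix (Fin n) (Fin n) ℂ}
    {U : Set (Fin s → ℂ)} (hU : IsOpen U) (hconn : IsPreconnected U)
    (hF : ∀ x ∈ U, ∀ p q, DifferentiableAt ℂ (fun y => F y p q) x)
    (hpd : ∀ j, ∀ x ∈ U, pd F j x = 0) {x y : Fin s → ℂ} (hx : x ∈ U) (hy : y ∈ U) :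
    F x = F y := by
  ext p q
  refine hU.is_const_of_fderiv_eq_zero (𝕜 := ℂ) (f := fun z => F z p q) hconn
    (fun z hz => (hF z hz p q).differentiableWithinAt) (fun z hz => ?_) hx hy
  refine ContinuousLinearMap.coe_injective (LinearMap.pi_ext' fun j => LinearMap.ext_ring ?_)
  exact congrFun (congrFun (hpd j z hz) p) q

end EntrywiseCalculus

theorem statement9 {n s : ℕ} (U : Set (Fin s → ℂ)) (hU : IsOpen U)
    (hconn : IsConnected U)
    (DD : Fin s → (Fin s → ℂ) → Matrix (Fin n) (Fin n) ℂ)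
    (hDcont : ∀ (j : Fin s) (p q : Fin n), ContinuousOn (fun x => DD j x p q) U)
    (T B : (Fin s → ℂ) → Matrix (Fin n) (Fin n) ℂ)
    (hTdiff : ∀ p q : Fin n, DifferentiableOn ℂ (fun x => T x p q) U)
    (hTinv : ∀ x ∈ U, IsUnit (T x).det)
    (hTeq : ∀ j : Fin s, ∀ x ∈ U, pd T j x = DD j x * T x)
    (hBdiff : ∀ p q : Fin n, DifferentiableOn ℂ (fun x => B x p q) U)
    (hBeq : ∀ j : Fin s, ∀ x ∈ U, pd B j x = DD j x * B x - B x * DD j x) :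
    -- λ ↦ T(λ)⁻¹ B(λ) T(λ) is constant on U
    (∀ x ∈ U, ∀ y ∈ U, (T x)⁻¹ * B x * T x = (T y)⁻¹ * B y * T y)
    ∧
    -- in particular, B has a constant Jordan form
    (∀ x₀ ∈ U, ∀ J : Matrix (Fin n) (Fin n) ℂ,
      B x₀ = T x₀ * J * (T x₀)⁻¹ → ∀ x ∈ U, B x = T x * J * (T x)⁻¹) := by
  have hT (x) (hx : x ∈ U) (p q : Fin n) : DifferentiableAt ℂ (fun y => T y p q) x :=
    (hTdiff p q).differentiableAt (hU.mem_nhds hx)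
  have hB (x) (hx : x ∈ U) (p q : Fin n) : DifferentiableAt ℂ (fun y => B y p q) x :=
    (hBdiff p q).differentiableAt (hU.mem_nhds hx)
  have hC (x) (hx : x ∈ U) :
      ∀ p q : Fin n, DifferentiableAt ℂ (fun y => ((T y)⁻¹ * B y * T y) p q) x :=
    differentiableAt_mul_entry
      (differentiableAt_mul_entry (differentiableAt_inv_entry (hT x hx) (hTinv x hx)) (hB x hx))
      (hT x hx)
  have hTC (x) (hx : x ∈ U) : T x * ((T x)⁻¹ * B x * T x) = B x * T x := by
    rw [Matrix.mul_assoc, Matrix.mul_nonsing_inv_cancel_left _ _ (hTinv x hx)]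
  have hpd (j : Fin s) (x) (hx : x ∈ U) : pd (fun y => (T y)⁻¹ * B y * T y) j x = 0 := by
    have key := pd_congr_of_eventuallyEq
      (Filter.eventually_of_mem (hU.mem_nhds hx) hTC) j
    rw [pd_mul (hT x hx) (hC x hx), pd_mul (hB x hx) (hT x hx), hTeq j x hx, hBeq j x hx,
      Matrix.mul_assoc (DD j x), hTC x hx, Matrix.sub_mul, Matrix.mul_assoc (B x),
      sub_add_cancel, Matrix.mul_assoc, add_eq_left] at key
    rw [← Matrix.nonsing_inv_mul_cancel_left (T x) (pd _ j x) (hTinv x hx), key,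
      Matrix.mul_zero]
  have hconst : ∀ x ∈ U, ∀ y ∈ U, (T x)⁻¹ * B x * T x = (T y)⁻¹ * B y * T y :=
    fun x hx y hy => eq_of_pd_eq_zero hU hconn.isPreconnected hC hpd hx hy
  refine ⟨hconst, fun x₀ hx₀ J hJ x hx => ?_⟩
  have hJ' : (T x)⁻¹ * B x * T x = J := by
    rw [hconst x hx x₀ hx₀, hJ, Matrix.mul_assoc (T x₀),
      Matrix.nonsing_inv_mul_cancel_left _ _ (hTinv x₀ hx₀),
      Matrix.nonsing_inv_mul_cancel_right _ _ (hTinv x₀ hx₀)]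
  rw [← hJ', hTC x hx, Matrix.mul_nonsing_inv_cancel_right _ _ (hTinv x hx)]
end
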